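/- For every nonzero λ ∈ k^c, the subalgebra k[u_λ] of A generated by u_λ is isomorphic as a k-algebra to the truncated polynomial ring k[x]/(x^a); in particular u_λ^{a−1} ≠ 0 and dim_k k[u_λ] = a. -/

import Mathlib

open scoped TensorProduct

/-- The relations defining the quantum complete intersection `A^c_q`:
`x_i ^ a = 0` for all `i`, and `x_i x_j = q • x_j x_i` for `i < j`. -/
inductive QCIRel (k : Type) [Field k] (c a : ℕ) (q : k) :
    FreeAlgebra k (Fin c) → FreeAlgebra k (Fin c) → Prop
  | pow (i : Fin c) : QCIRel k c a q (FreeAlgebra.ι k i ^ a) 0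
  | comm (i j : Fin c) (hij : i < j) :
      QCIRel k c a q (FreeAlgebra.ι k i * FreeAlgebra.ι k j)
        (q • (FreeAlgebra.ι k j * FreeAlgebra.ι k i))

/-- The quantum complete intersection algebra `A^c_q = k⟨x_1,…,x_c⟩/(x_i^a, x_ix_j - q x_jx_i)`. -/
def QCI (k : Type) [Field k] (c a : ℕ) (q : k) : Type := RingQuot (QCIRel k c a q)

noncomputable instance (k : Type) [Field k] (c a : ℕ) (q : k) : Ring (QCI k c a q) :=
  inferInstanceAs (Ring (RingQuot (QCIRel k c a q)))

noncomputable instance (k : Type) [Field k] (c a : ℕ) (q : k) : Algebra k (QCI k c a q) :=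
  inferInstanceAs (Algebra k (RingQuot (QCIRel k c a q)))

namespace QCI

variable (k : Type) [Field k] (c a : ℕ) (q : k)

/-- The generators `x_i` of the quantum complete intersection. -/
noncomputable def x (i : Fin c) : QCI k c a q :=
  RingQuot.mkAlgHom k (QCIRel k c a q) (FreeAlgebra.ι k i)

/-- The element `u_λ = λ_1 x_1 + ⋯ + λ_c x_c` of `A^c_q`. -/
noncomputable def u (lam : Fin c → k) : QCI k c a q :=
  ∑ i, lam i • QCI.x k c a q i

end QCI

/-- `a' = a / gcd(a, char k)` if `char k > 0`, and `a' = a` if `char k = 0`. -/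
noncomputable def aprime (k : Type) [Field k] (a : ℕ) : ℕ :=
  if ringChar k > 0 then a / Nat.gcd a (ringChar k) else a

set_option synthInstance.maxHeartbeats 1000000

/-- The Gaussian binomial coefficient `[m choose j]_q`, defined by the `q`-Pascal recursion. -/
def qChoose {R : Type*} [CommRing R] (q : R) : ℕ → ℕ → R
  | _, 0 => 1
  | 0, _ + 1 => 0
  | m + 1, j + 1 => qChoose q m j + q ^ (j + 1) * qChoose q m (j + 1)

section qChoose

variable {R : Type*} [CommRing R] (q : R)

@[simp] lemma qChoose_zero_right (m : ℕ) : qChoose q m 0 = 1 := by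
  cases m <;> rfl

lemma qChoose_succ_succ (m j : ℕ) :
    qChoose q (m + 1) (j + 1) = qChoose q m j + q ^ (j + 1) * qChoose q m (j + 1) := rfl

lemma qChoose_eq_zero_of_lt {m j : ℕ} (h : m < j) : qChoose q m j = 0 := by
  induction m generalizing j with
  | zero => obtain ⟨j, rfl⟩ := Nat.exists_eq_add_of_lt h; rfl
  | succ m ih =>
    obtain ⟨j, rfl⟩ : ∃ i, j = i + 1 := ⟨j - 1, by omega⟩
    rw [qChoose_succ_succ, ih (by omega), ih (by omega), mul_zero, add_zero]

@[simp] lemma qChoose_self (m : ℕ) : qChoose q m m = 1 := by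
  induction m with
  | zero => rfl
  | succ m ih => rw [qChoose_succ_succ, ih, qChoose_eq_zero_of_lt q m.lt_succ_self, mul_zero,
      add_zero]

/-- The absorption identity for Gaussian binomial coefficients. -/
lemma one_sub_pow_mul_qChoose_succ_succ (m j : ℕ) :
    (1 - q ^ (j + 1)) * qChoose q (m + 1) (j + 1) = (1 - q ^ (m + 1)) * qChoose q m j := by
  induction m generalizing j with
  | zero =>
    cases j with
    | zero => simp
    | succ j => rw [qChoose_eq_zero_of_lt q (show 0 + 1 < j + 1 + 1 by omega),
        qChoose_eq_zero_of_lt q j.succ_pos, mul_zero, mul_zero]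
  | succ m ih =>
    cases j with
    | zero =>
      have h := ih 0
      rw [qChoose_succ_succ q (m + 1) 0]
      simp only [qChoose_zero_right, zero_add, pow_one, mul_one] at h ⊢
      linear_combination q * h
    | succ j =>
      have h := ih j
      have h' := ih (j + 1)
      have e := qChoose_succ_succ q m j
      rw [qChoose_succ_succ q (m + 1) (j + 1)]
      linear_combination q ^ (j + 2) * h' + q * h - q * (1 - q ^ (m + 1)) * e

lemma IsPrimitiveRoot.qChoose_eq_zero [IsDomain R] {q : R} {n : ℕ} (hq : IsPrimitiveRoot q n)
    {j : ℕ} (hj : 0 < j) (hjn : j < n) : qChoose q n j = 0 := by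
  obtain ⟨j, rfl⟩ : ∃ i, j = i + 1 := ⟨j - 1, by omega⟩
  obtain ⟨n, rfl⟩ : ∃ i, n = i + 1 := ⟨n - 1, by omega⟩
  have h := one_sub_pow_mul_qChoose_succ_succ q n j
  rw [hq.pow_eq_one, sub_self, zero_mul] at h
  exact (mul_eq_zero.mp h).resolve_left
    (sub_ne_zero.mpr (hq.pow_ne_one_of_pos_of_lt hj.ne' hjn).symm)

end qChoose

section qCommute

variable {R A : Type*} [CommRing R] [Ring A] [Algebra R A] {q : R} {x y : A}

lemma mul_pow_of_qCommute (h : x * y = q • (y * x)) (j : ℕ) :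
    x * y ^ j = q ^ j • (y ^ j * x) := by
  induction j with
  | zero => simp
  | succ j ih =>
    rw [pow_succ, ← mul_assoc, ih, smul_mul_assoc, mul_assoc, h, mul_smul_comm, smul_smul,
      ← mul_assoc, ← pow_succ]

lemma commute_pow_right_of_qCommute {n : ℕ} (h : x * y = q • (y * x)) (hq : q ^ n = 1) :
    Commute x (y ^ n) := by
  rw [commute_iff_eq, mul_pow_of_qCommute h, hq, one_smul]

/-- The noncommutative `q`-binomial theorem. -/
lemma add_pow_of_qCommute (h : x * y = q • (y * x)) (m : ℕ) :
    (y + x) ^ m = ∑ j ∈ Finset.range (m + 1), qChoose q m j • (y ^ j * x ^ (m - j)) := by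
  induction m with
  | zero => simp
  | succ m ih =>
    have hx : x * (y + x) ^ m = ∑ j ∈ Finset.range (m + 2),
        (q ^ j * qChoose q m j) • (y ^ j * x ^ (m + 1 - j)) := by
      rw [Finset.sum_range_succ, qChoose_eq_zero_of_lt q m.lt_succ_self, mul_zero, zero_smul,
        add_zero, ih, Finset.mul_sum]
      refine Finset.sum_congr rfl fun j hj => ?_
      rw [mul_smul_comm, ← mul_assoc, mul_pow_of_qCommute h, smul_mul_assoc, mul_assoc,
        ← pow_succ', smul_smul, mul_comm (qChoose q m j),
        Nat.succ_sub (Finset.mem_range_succ_iff.mp hj)]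
    rw [pow_succ', add_mul, hx, ih, Finset.mul_sum, Finset.sum_range_succ' _ (m + 1),
      Finset.sum_range_succ' _ (m + 1), ← add_assoc, ← Finset.sum_add_distrib]
    congr 1
    · refine Finset.sum_congr rfl fun j _ => ?_
      rw [mul_smul_comm, ← mul_assoc, ← pow_succ', Nat.add_sub_add_right, ← add_smul,
        qChoose_succ_succ]
    · simp

lemma IsPrimitiveRoot.add_pow_of_qCommute [IsDomain R] {n : ℕ} (hq : IsPrimitiveRoot q n)
    (hn : 0 < n) (h : x * y = q • (y * x)) : (y + x) ^ n = y ^ n + x ^ n := by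
  obtain ⟨n, rfl⟩ : ∃ i, n = i + 1 := ⟨n - 1, by omega⟩
  rw [_root_.add_pow_of_qCommute h, Finset.sum_range_succ, Finset.sum_range_succ',
    Finset.sum_eq_zero, qChoose_self]
  · simp [add_comm]
  · intro j hj
    rw [hq.qChoose_eq_zero j.succ_pos (by simpa using hj), zero_smul]

lemma IsPrimitiveRoot.sum_pow_of_qCommute [IsDomain R] {ι : Type*} [LinearOrder ι] {n : ℕ}
    (hq : IsPrimitiveRoot q n) (hn : 0 < n) {z : ι → A}
    (h : ∀ i j, i < j → z i * z j = q • (z j * z i)) (s : Finset ι) :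
    (∑ i ∈ s, z i) ^ n = ∑ i ∈ s, z i ^ n := by
  induction s using Finset.induction_on_min with
  | empty => simp [hn.ne']
  | insert i s hi ih =>
    have his : i ∉ s := fun hmem => lt_irrefl i (hi i hmem)
    rw [Finset.sum_insert his, Finset.sum_insert his, add_comm (z i), add_comm (z i ^ n), ← ih]
    refine hq.add_pow_of_qCommute hn ?_
    rw [Finset.mul_sum, Finset.sum_mul, Finset.smul_sum]
    exact Finset.sum_congr rfl fun j hj => h i j (hi j hj)

end qCommute

lemma sum_pow_char_of_pairwise_commute {A ι : Type*} [Ring A] (p : ℕ) [Fact p.Prime] [CharP A p]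
    {z : ι → A} (h : Pairwise fun i j => Commute (z i) (z j)) (s : Finset ι) :
    (∑ i ∈ s, z i) ^ p = ∑ i ∈ s, z i ^ p := by
  classical
  induction s using Finset.induction_on with
  | empty => simp [(Fact.out : p.Prime).ne_zero]
  | insert i s hi ih =>
    rw [Finset.sum_insert hi, Finset.sum_insert hi, ← ih]
    refine add_pow_char_of_commute p (Commute.sum_right _ _ _ fun j hj => h ?_)
    rintro rfl
    exact hi hj

/-- A `q`-commuting sum of elements whose `a`-th powers vanish has vanishing `a`-th power. -/
lemma sum_pow_eq_zero_of_qCommute {k A ι : Type} [Field k] [Ring A] [Algebra k A] [LinearOrder ι]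
    {a : ℕ} (ha : 0 < a) {q : k} (hq : IsPrimitiveRoot q (aprime k a)) {z : ι → A}
    (h : ∀ i j, i < j → z i * z j = q • (z j * z i)) (hz : ∀ i, z i ^ a = 0) (s : Finset ι) :
    (∑ i ∈ s, z i) ^ a = 0 := by
  nontriviality A
  by_cases hp : 0 < ringChar k ∧ ringChar k ∣ a
  · obtain ⟨hp, n, rfl⟩ := hp
    set p := ringChar k with hpdef
    have hprime : Fact p.Prime := ⟨(CharP.char_is_prime_or_zero k p).resolve_right hp.ne'⟩
    have : CharP A p := charP_of_injective_algebraMap (algebraMap k A).injective p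
    have hn : aprime k (p * n) = n := by
      rw [aprime, if_pos hp, ← hpdef, Nat.gcd_eq_right (dvd_mul_right p n),
        Nat.mul_div_cancel_left _ hp]
    rw [hn] at hq
    have hcomm : ∀ i j, i < j → Commute (z i ^ n) (z j ^ n) := fun i j hij =>
      (commute_pow_right_of_qCommute (h i j hij) hq.pow_eq_one).pow_left n
    rw [mul_comm, pow_mul, hq.sum_pow_of_qCommute (Nat.pos_of_mul_pos_left ha) h,
      sum_pow_char_of_pairwise_commute p]
    · exact Finset.sum_eq_zero fun i _ => by rw [← pow_mul, mul_comm, hz]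
    · intro i j hij
      rcases lt_or_gt_of_ne hij with hlt | hlt
      · exact hcomm i j hlt
      · exact (hcomm j i hlt).symm
  · have hn : aprime k a = a := by
      rw [aprime]
      split_ifs with hpos
      · have hprime := (CharP.char_is_prime_or_zero k (ringChar k)).resolve_right hpos.ne'
        rw [((hprime.coprime_iff_not_dvd).mpr fun hd => hp ⟨hpos, hd⟩).symm.gcd_eq_one,
          Nat.div_one]
      · rfl
    rw [hn] at hq
    rw [hq.sum_pow_of_qCommute ha h]
    exact Finset.sum_eq_zero fun i _ => hz i

namespace QCI

variable {k : Type} [Field k] {c a : ℕ} {q : k}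

lemma x_pow (i : Fin c) : x k c a q i ^ a = 0 := by
  have h := RingQuot.mkAlgHom_rel k (QCIRel.pow (k := k) (a := a) (q := q) i)
  rw [map_pow, map_zero] at h
  exact h

lemma x_mul_x {i j : Fin c} (hij : i < j) :
    x k c a q i * x k c a q j = q • (x k c a q j * x k c a q i) := by
  have h := RingQuot.mkAlgHom_rel k (QCIRel.comm (a := a) (q := q) i j hij)
  rw [map_mul, map_smul, map_mul] at h
  exact h

lemma u_pow_eq_zero (ha : 0 < a) (hq : IsPrimitiveRoot q (aprime k a)) (lam : Fin c → k) :
    u k c a q lam ^ a = 0 := by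
  refine sum_pow_eq_zero_of_qCommute ha hq (fun i j hij => ?_) (fun i => ?_) _
  · rw [smul_mul_smul_comm, smul_mul_smul_comm, x_mul_x hij, smul_comm, mul_comm (lam i)]
  · rw [smul_pow, x_pow, smul_zero]

/-- If `b ^ a = 0`, there is an algebra map `A^c_q → B` sending `x_i` to `b` and the other generators
to `0`. -/
lemma exists_algHom_x_eq_single {B : Type} [Ring B] [Algebra k B] (ha : a ≠ 0) (i : Fin c) (b : B)
    (hb : b ^ a = 0) :
    ∃ φ : QCI k c a q →ₐ[k] B, ∀ j, φ (x k c a q j) = (Pi.single i b : Fin c → B) j := by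
  have hrel : ∀ ⦃s t⦄, QCIRel k c a q s t →
      FreeAlgebra.lift k (Pi.single i b : Fin c → B) s =
        FreeAlgebra.lift k (Pi.single i b : Fin c → B) t := by
    rintro _ _ (j | ⟨j, l, hjl⟩)
    · rcases eq_or_ne j i with rfl | hj
      · simp [hb]
      · simp [hj, ha]
    · rcases eq_or_ne j i with rfl | hj
      · simp [hjl.ne']
      · simp [hj]
  exact ⟨RingQuot.liftAlgHom k ⟨_, hrel⟩, fun j =>
    (RingQuot.liftAlgHom_mkAlgHom_apply k _ hrel _).trans (FreeAlgebra.lift_ι_apply _ _)⟩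

lemma u_pow_ne_zero (ha : a ≠ 0) {lam : Fin c → k} (hlam : lam ≠ 0) :
    u k c a q lam ^ (a - 1) ≠ 0 := by
  obtain ⟨i, hi⟩ := Function.ne_iff.mp hlam
  have hX : Ideal.Quotient.mk (Ideal.span {(Polynomial.X : Polynomial k) ^ a}) Polynomial.X ^ a
      = 0 := by
    rw [← map_pow, Ideal.Quotient.eq_zero_iff_dvd]
  obtain ⟨φ, hφ⟩ := exists_algHom_x_eq_single (q := q) ha i _ hX
  intro h
  have hu : φ (u k c a q lam) = lam i • Ideal.Quotient.mk _ Polynomial.X := by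
    rw [u, map_sum, Finset.sum_eq_single i]
    · rw [map_smul, hφ, Pi.single_eq_same]
    · intro j _ hj
      rw [map_smul, hφ, Pi.single_eq_of_ne hj, smul_zero]
    · simp
  have h0 := congrArg φ h
  rw [map_pow, map_zero, hu, smul_pow, smul_eq_zero_iff_right (pow_ne_zero _ hi), ← map_pow,
    Ideal.Quotient.eq_zero_iff_dvd,
    pow_dvd_pow_iff Polynomial.X_ne_zero Polynomial.not_isUnit_X] at h0
  omega

end QCI

lemma minpoly_eq_X_pow {k A : Type*} [Field k] [Ring A] [Algebra k A] {a : ℕ} (ha : a ≠ 0)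
    {v : A} (h0 : v ^ a = 0) (h1 : v ^ (a - 1) ≠ 0) : minpoly k v = Polynomial.X ^ a := by
  have hint : IsIntegral k v := ⟨Polynomial.X ^ a, Polynomial.monic_X_pow a, by simp [h0]⟩
  have hdvd : minpoly k v ∣ Polynomial.X ^ a := minpoly.dvd k v (by simp [h0])
  obtain ⟨m, hm, hassoc⟩ := (dvd_prime_pow Polynomial.prime_X a).mp hdvd
  have heq := Polynomial.eq_of_monic_of_associated (minpoly.monic hint)
    (Polynomial.monic_X_pow m) hassoc
  have hv : v ^ m = 0 := by simpa [heq] using minpoly.aeval k v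
  rcases hm.lt_or_eq with hlt | rfl
  · exact absurd (pow_eq_zero_of_le (by omega) hv) h1
  · exact heq

/-- The subalgebra generated by an element of a not necessarily commutative algebra over a field
is the quotient of the polynomial ring by the minimal polynomial. -/
noncomputable def adjoinSingletonEquivQuotientMinpoly {k A : Type*} [Field k] [Ring A]
    [Algebra k A] (v : A) :
    Algebra.adjoin k {v} ≃ₐ[k] (Polynomial k ⧸ Ideal.span {minpoly k v}) :=
  (Subalgebra.equivOfEq _ _ (Algebra.adjoin_singleton_eq_range_aeval k v)).trans
    ((Ideal.quotientKerAlgEquivOfSurjective (Polynomial.aeval v).rangeRestrict_surjective).symm.trans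
      (Ideal.quotientEquivAlgOfEq k (by
        ext f
        rw [Ideal.mem_span_singleton, minpoly.dvd_iff, AlgHom.ker_rangeRestrict, RingHom.mem_ker])))

/-- For every nonzero `λ ∈ k^c`, the subalgebra `k[u_λ]` of `A = A^c_q` generated by `u_λ` is
isomorphic as a `k`-algebra to the truncated polynomial ring `k[x]/(x^a)`; in particular
`u_λ^{a-1} ≠ 0` and `dim_k k[u_λ] = a`. -/
theorem adjoin_uLam_iso_truncatedPolynomial (k : Type) [Field k] [IsAlgClosed k] (a c : ℕ)
    (ha : 2 ≤ a) (hc : 1 ≤ c) (q : k) (hq : IsPrimitiveRoot q (aprime k a))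
    (lam : Fin c → k) (hlam : lam ≠ 0) :
    Nonempty ((Algebra.adjoin k {QCI.u k c a q lam}) ≃ₐ[k]
        (Polynomial k ⧸ Ideal.span {(Polynomial.X : Polynomial k) ^ a}))
    ∧ QCI.u k c a q lam ^ (a - 1) ≠ 0
    ∧ Module.finrank k (Algebra.adjoin k {QCI.u k c a q lam}) = a := by
  have ha' : a ≠ 0 := by omega
  have h1 := QCI.u_pow_ne_zero (q := q) ha' hlam
  have e := adjoinSingletonEquivQuotientMinpoly (k := k) (QCI.u k c a q lam)
  rw [minpoly_eq_X_pow ha' (QCI.u_pow_eq_zero (by omega) hq lam) h1] at e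
  refine ⟨⟨e⟩, h1, ?_⟩
  rw [e.toLinearEquiv.finrank_eq, finrank_quotient_span_eq_natDegree, Polynomial.natDegree_X_pow]
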